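/- Linear lower bound in terms of few-particle energies: for every α ∈ [0,1] and every integer N ≥ 2, E^N_N(α) ≥ (N/4) · min{ E^N_2(α), E^N_3(α), E^N_4(α) }. -/

import Mathlib

noncomputable section

open MeasureTheory Real Set
open scoped BigOperators Topology

/-- The plane `ℝ²`, with points written as pairs. -/
abbrev Plane : Type := ℝ × ℝ

/-- Configuration space of `N` particles in the plane. -/
abbrev Config (N : ℕ) : Type := Fin N → Plane

/-- `x^{-⊥} := (-y, x)/(x² + y²)` for `x = (x, y) ∈ ℝ²`. -/
def perpInv (v : Plane) : Plane :=
  (-v.2 / (v.1 ^ 2 + v.2 ^ 2), v.1 / (v.1 ^ 2 + v.2 ^ 2))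

/-- The Aharonov–Bohm potential `A_j(x) = ∑_{k ≠ j} (x_j - x_k)^{-⊥}`. -/
def abPot (N : ℕ) (j : Fin N) (x : Config N) : Plane :=
  ∑ k ∈ Finset.univ.erase j, perpInv (x j - x k)

/-- Partial derivative of `Ψ` at `x` in direction `v` of the `j`-th particle. -/
def pder (N : ℕ) (j : Fin N) (v : Plane) (Ψ : Config N → ℂ) (x : Config N) : ℂ :=
  fderiv ℝ Ψ x (Pi.single j v)

/-- The two components of `D_j Ψ = -i ∇_{x_j} Ψ + α A_j Ψ` at `x`. -/
def DOp (N : ℕ) (α : ℝ) (j : Fin N) (Ψ : Config N → ℂ) (x : Config N) : ℂ × ℂ :=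
  (-Complex.I * pder N j (1, 0) Ψ x + Complex.ofReal (α * (abPot N j x).1) * Ψ x,
   -Complex.I * pder N j (0, 1) Ψ x + Complex.ofReal (α * (abPot N j x).2) * Ψ x)

/-- `|D_j Ψ(x)|²`, the squared Euclidean norm of the vector `D_j Ψ(x) ∈ ℂ²`. -/
def DSq (N : ℕ) (α : ℝ) (j : Fin N) (Ψ : Config N → ℂ) (x : Config N) : ℝ :=
  ‖(DOp N α j Ψ x).1‖ ^ 2 + ‖(DOp N α j Ψ x).2‖ ^ 2

/-- The diagonal set `{x : x_j = x_k for some j ≠ k}`. -/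
def diagSet (N : ℕ) : Set (Config N) := {x | ∃ j k : Fin N, j ≠ k ∧ x j = x k}

/-- Admissible wave functions: smooth, symmetric, vanishing on a neighbourhood of
the diagonal set. -/
structure Admissible (N : ℕ) (Ψ : Config N → ℂ) : Prop where
  smooth : ContDiff ℝ (⊤ : ℕ∞) Ψ
  symm : ∀ (σ : Equiv.Perm (Fin N)) (x : Config N), Ψ (x ∘ σ) = Ψ x
  vanishes : ∃ U : Set (Config N), IsOpen U ∧ diagSet N ⊆ U ∧ ∀ x ∈ U, Ψ x = 0

/-- `Ω^N` as a subset of configuration space. -/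
def cube (N : ℕ) (Ω : Set Plane) : Set (Config N) := Set.univ.pi fun _ => Ω

/-- Total kinetic energy `∑_j ∫_{Ω^N} |D_j Ψ|²`. -/
def kinE (N : ℕ) (α : ℝ) (Ω : Set Plane) (Ψ : Config N → ℂ) : ℝ :=
  ∑ j, ∫ x in cube N Ω, DSq N α j Ψ x

/-- `∫_{Ω^N} |Ψ|²`. -/
def normSq (N : ℕ) (Ω : Set Plane) (Ψ : Config N → ℂ) : ℝ :=
  ∫ x in cube N Ω, ‖Ψ x‖ ^ 2

/-- Neumann ground-state energy of `N` anyons with statistics parameter `α` on `Ω`,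
with the convention that it is `0` for `N = 0`. -/
def neumannE (N : ℕ) (α : ℝ) (Ω : Set Plane) : ℝ :=
  if N = 0 then 0 else
    sInf {E | ∃ Ψ : Config N → ℂ, Admissible N Ψ ∧ normSq N Ω Ψ = 1 ∧ E = kinE N α Ω Ψ}

/-- Dirichlet ground-state energy of `N` anyons with statistics parameter `α` on `Ω`. -/
def dirichletE (N : ℕ) (α : ℝ) (Ω : Set Plane) : ℝ :=
  sInf {E | ∃ Ψ : Config N → ℂ, Admissible N Ψ ∧ IsCompact (tsupport Ψ) ∧
    tsupport Ψ ⊆ cube N Ω ∧ normSq N Ω Ψ = 1 ∧ E = kinE N α Ω Ψ}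

/-- The open unit square `Q₀ = (0,1)²`. -/
def Q0 : Set Plane := Set.Ioo (0 : ℝ) 1 ×ˢ Set.Ioo (0 : ℝ) 1

/-- `E^N_N(α)`, the Neumann energy on the unit square. -/
def EN (N : ℕ) (α : ℝ) : ℝ := neumannE N α Q0

/-- `E^D_N(α)`, the Dirichlet energy on the unit square. -/
def ED (N : ℕ) (α : ℝ) : ℝ := dirichletE N α Q0

/-- One-particle density `ρ_Ψ` of a wave function of `n+1` particles. -/
def density (n : ℕ) (Ψ : Config (n + 1) → ℂ) (y : Plane) : ℝ :=
  (n + 1) * ∫ z : Config n, ‖Ψ (Fin.cons y z)‖ ^ 2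


def hfun (δ t : ℝ) : ℝ := t / (t ^ 2 + expNegInvGlue (δ ^ 2 - t ^ 2))

lemma hfun_den_pos (δ : ℝ) (hδ : 0 < δ) (t : ℝ) :
    0 < t ^ 2 + expNegInvGlue (δ ^ 2 - t ^ 2) := by
  by_cases ht : t = 0
  · subst ht
    have : 0 < expNegInvGlue (δ ^ 2 - 0 ^ 2) := expNegInvGlue.pos_of_pos (by nlinarith)
    positivity
  · have := expNegInvGlue.nonneg (δ ^ 2 - t ^ 2)
    positivity

lemma hfun_contDiff (δ : ℝ) (hδ : 0 < δ) : ContDiff ℝ (⊤ : ℕ∞) (hfun δ) := by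
  unfold hfun
  refine ContDiff.div contDiff_id ?_ (fun t => (hfun_den_pos δ hδ t).ne')
  refine (contDiff_id.pow 2).add ?_
  exact expNegInvGlue.contDiff.comp (contDiff_const.sub (contDiff_id.pow 2))

lemma hfun_eq (δ : ℝ) (hδ : 0 < δ) (t : ℝ) (ht : δ < |t|) : hfun δ t = t⁻¹ := by
  unfold hfun
  have h2 : δ ^ 2 - t ^ 2 ≤ 0 := by
    have := sq_abs t
    nlinarith [abs_nonneg t]
  have h0 : t ≠ 0 := by
    rintro rfl
    simp at ht; linarith
  rw [expNegInvGlue.zero_of_nonpos h2]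
  field_simp
  simp

/-- The linear form `v ↦ w · v`. -/
def dotL (w : Plane) : Plane →L[ℝ] ℝ :=
  w.1 • ContinuousLinearMap.fst ℝ ℝ ℝ + w.2 • ContinuousLinearMap.snd ℝ ℝ ℝ

lemma dotL_apply (w v : Plane) : dotL w v = w.1 * v.1 + w.2 * v.2 := by
  simp [dotL]

lemma theta1 (δ : ℝ) (hδ : 0 < δ) (y : Plane) :
    ∃ θ : Plane → ℝ, ContDiff ℝ (⊤ : ℕ∞) θ ∧ ∀ x : Plane, δ < |x.1 - y.1| →
      HasFDerivAt θ (dotL (perpInv (x - y))) x := by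
  refine ⟨fun x => Real.arctan ((x.2 - y.2) * hfun δ (x.1 - y.1)), ?_, ?_⟩
  · refine Real.contDiff_arctan.comp (ContDiff.mul (contDiff_snd.sub contDiff_const) ?_)
    exact (hfun_contDiff δ hδ).comp (contDiff_fst.sub contDiff_const)
  · intro x hx
    have h0 : x.1 - y.1 ≠ 0 := by
      intro h; rw [h] at hx; simp at hx; linarith
    have e1 : (fun x : Plane => Real.arctan ((x.2 - y.2) * hfun δ (x.1 - y.1))) =ᶠ[𝓝 x]
        fun x => Real.arctan ((x.2 - y.2) * (x.1 - y.1)⁻¹) := by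
      have : ∀ᶠ z : Plane in 𝓝 x, δ < |z.1 - y.1| := by
        have ho : IsOpen {z : Plane | δ < |z.1 - y.1|} :=
          isOpen_lt continuous_const (by fun_prop)
        exact ho.mem_nhds hx
      filter_upwards [this] with z hz
      rw [hfun_eq δ hδ _ hz]
    refine HasFDerivAt.congr_of_eventuallyEq ?_ e1
    have d1 : HasFDerivAt (fun x : Plane => x.1 - y.1) (ContinuousLinearMap.fst ℝ ℝ ℝ) x :=
      hasFDerivAt_fst.sub_const _
    have d2 : HasFDerivAt (fun x : Plane => x.2 - y.2) (ContinuousLinearMap.snd ℝ ℝ ℝ) x :=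
      hasFDerivAt_snd.sub_const _
    have d3 := (hasDerivAt_inv h0).comp_hasFDerivAt x d1
    have d4 := (d2.mul d3).arctan
    refine d4.congr_fderiv ?_
    ext <;>
    · have : 0 < (x.1 - y.1) ^ 2 + (x.2 - y.2) ^ 2 := by positivity
      simp [dotL, perpInv]
      field_simp
      try ring

lemma theta2 (δ : ℝ) (hδ : 0 < δ) (y : Plane) :
    ∃ θ : Plane → ℝ, ContDiff ℝ (⊤ : ℕ∞) θ ∧ ∀ x : Plane, δ < |x.2 - y.2| →
      HasFDerivAt θ (dotL (perpInv (x - y))) x := by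
  obtain ⟨θ, h1, h2⟩ := theta1 δ hδ (y.2, y.1)
  refine ⟨fun x => - θ (x.2, x.1), ?_, ?_⟩
  · exact (h1.comp (contDiff_snd.prodMk contDiff_fst)).neg
  · intro x hx
    have hs : HasFDerivAt (fun x : Plane => (x.2, x.1))
        ((ContinuousLinearMap.snd ℝ ℝ ℝ).prod (ContinuousLinearMap.fst ℝ ℝ ℝ)) x :=
      hasFDerivAt_snd.prodMk hasFDerivAt_fst
    have := HasFDerivAt.comp (f := fun x : Plane => (x.2, x.1)) x (h2 (x.2, x.1) hx) hs
    refine this.neg.congr_fderiv ?_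
    ext <;>
    · simp [dotL, perpInv]
      try ring

def off (b : Bool) : ℝ := if b then 1 / 2 else 0

def cell (c : Bool × Bool) : Set Plane :=
  Set.Ioo (off c.1) (off c.1 + 1 / 2) ×ˢ Set.Ioo (off c.2) (off c.2 + 1 / 2)

def pt (c : Bool × Bool) : Plane := (off c.1, off c.2)

def aff (c : Bool × Bool) (x : Plane) : Plane := pt c + (1 / 2 : ℝ) • x

lemma theta_cell (c c' : Bool × Bool) (hc : c ≠ c') (y : Plane) (hy : y ∈ cell c') :
    ∃ θ : Plane → ℝ, ContDiff ℝ (⊤ : ℕ∞) θ ∧ ∀ x ∈ cell c,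
      HasFDerivAt θ (dotL (perpInv (x - y))) x := by
  have key : ∀ (b b' : Bool) (s : ℝ), b ≠ b' → s ∈ Set.Ioo (off b') (off b' + 1 / 2) →
      ∃ δ > 0, ∀ t ∈ Set.Ioo (off b) (off b + 1 / 2), δ < |t - s| := by
    intro b b' s hb hs
    refine ⟨|s - 1 / 2|, ?_, ?_⟩
    · rw [gt_iff_lt, abs_pos]
      cases b <;> cases b' <;> simp [off] at * <;> intro h <;> linarith [hs.1, hs.2]
    · intro t ht
      cases b <;> cases b' <;> simp [off] at *
      · rw [abs_of_pos (by linarith), abs_of_neg (by linarith)]; linarith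
      · rw [abs_of_neg (by linarith), abs_of_pos (by linarith)]; linarith
  by_cases h1 : c.1 = c'.1
  · have h2 : c.2 ≠ c'.2 := fun h => hc (Prod.ext h1 h)
    obtain ⟨δ, hδ, hh⟩ := key c.2 c'.2 y.2 h2 hy.2
    obtain ⟨θ, a, b⟩ := theta2 δ hδ y
    exact ⟨θ, a, fun x hx => b x (hh _ hx.2)⟩
  · obtain ⟨δ, hδ, hh⟩ := key c.1 c'.1 y.1 h1 hy.1
    obtain ⟨θ, a, b⟩ := theta1 δ hδ y
    exact ⟨θ, a, fun x hx => b x (hh _ hx.1)⟩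

lemma aff_mem_cell (c : Bool × Bool) (x : Plane) : aff c x ∈ cell c ↔ x ∈ Q0 := by
  simp only [aff, cell, pt, Q0, Set.mem_prod, Set.mem_Ioo, Prod.fst_add, Prod.snd_add,
    Prod.smul_fst, Prod.smul_snd, smul_eq_mul]
  constructor
  · rintro ⟨⟨_, _⟩, _, _⟩
    refine ⟨⟨?_, ?_⟩, ?_, ?_⟩ <;> linarith
  · rintro ⟨⟨_, _⟩, _, _⟩
    refine ⟨⟨?_, ?_⟩, ?_, ?_⟩ <;> linarith

lemma cell_subset (c : Bool × Bool) : cell c ⊆ Q0 := by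
  rintro x ⟨⟨h1, h2⟩, h3, h4⟩
  obtain ⟨a, b⟩ := c
  refine ⟨⟨?_, ?_⟩, ?_, ?_⟩ <;> cases a <;> cases b <;> simp [off] at * <;> linarith

lemma continuous_DSq (N : ℕ) (α : ℝ) (j : Fin N) (Ψ : Config N → ℂ) (h : Admissible N Ψ) :
    Continuous (DSq N α j Ψ) := by
  have hp : ∀ v, Continuous (pder N j v Ψ) := by
    intro v
    unfold pder
    exact (h.smooth.continuous_fderiv (by simp)).clm_apply continuous_const
  have hA : ∀ (F : Plane → ℝ), Continuous F →
      Continuous (fun x => Complex.ofReal (α * F (abPot N j x)) * Ψ x) := by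
    intro F hF
    rw [continuous_iff_continuousAt]
    intro x
    by_cases hx : x ∈ diagSet N
    · obtain ⟨U, hU, hd, hz⟩ := h.vanishes
      have : (fun x => Complex.ofReal (α * F (abPot N j x)) * Ψ x) =ᶠ[𝓝 x] fun _ => 0 := by
        filter_upwards [hU.mem_nhds (hd hx)] with z hzz
        rw [hz z hzz, mul_zero]
      exact continuousAt_const.congr this.symm
    · refine ContinuousAt.mul ?_ h.smooth.continuous.continuousAt
      refine Complex.continuous_ofReal.continuousAt.comp ?_
      refine continuousAt_const.mul (hF.continuousAt.comp ?_)
      unfold abPot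
      refine tendsto_finsetSum _ ?_
      intro k hk
      have hk' : x j - x k ≠ 0 := by
        intro h0
        exact hx ⟨j, k, (Finset.ne_of_mem_erase hk).symm, sub_eq_zero.mp h0⟩
      have hne : (x j - x k).1 ^ 2 + (x j - x k).2 ^ 2 ≠ 0 := by
        intro h0
        apply hk'
        have a1 : (x j - x k).1 = 0 := by nlinarith [sq_nonneg (x j - x k).1, sq_nonneg (x j - x k).2]
        have a2 : (x j - x k).2 = 0 := by nlinarith [sq_nonneg (x j - x k).1, sq_nonneg (x j - x k).2]
        exact Prod.ext a1 a2
      have : ContinuousAt perpInv (x j - x k) := by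
        unfold perpInv
        refine ContinuousAt.prodMk ?_ ?_
        · exact ContinuousAt.div (by fun_prop) (by fun_prop) hne
        · exact ContinuousAt.div (by fun_prop) (by fun_prop) hne
      exact ContinuousAt.comp (f := fun x : Config N => x j - x k) (x := x) this (by fun_prop)
  have h1 := hA Prod.fst continuous_fst
  have h2 := hA Prod.snd continuous_snd
  have h3 := hp (1, 0)
  have h4 := hp (0, 1)
  unfold DSq DOp
  simp only
  fun_prop

lemma perpInv_zero : perpInv 0 = 0 := by simp [perpInv]

lemma abPot_eq (N : ℕ) (j : Fin N) (x : Config N) :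
    abPot N j x = ∑ k, perpInv (x j - x k) := by
  unfold abPot
  rw [Finset.sum_erase]
  rw [sub_self, perpInv_zero]

lemma perpInv_half (w : Plane) : perpInv ((1 / 2 : ℝ) • w) = (2 : ℝ) • perpInv w := by
  by_cases h : w.1 ^ 2 + w.2 ^ 2 = 0
  · have a1 : w.1 = 0 := by nlinarith [sq_nonneg w.1, sq_nonneg w.2]
    have a2 : w.2 = 0 := by nlinarith [sq_nonneg w.1, sq_nonneg w.2]
    have : w = 0 := Prod.ext a1 a2
    subst this
    simp [perpInv_zero]
  · have h' : (1 / 2 * w.1) ^ 2 + (1 / 2 * w.2) ^ 2 ≠ 0 := by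
      intro h0; apply h; linarith
    ext
    · simp only [perpInv, Prod.smul_fst, Prod.smul_snd, smul_eq_mul]
      field_simp
    · simp only [perpInv, Prod.smul_fst, Prod.smul_snd, smul_eq_mul]
      field_simp

section gauge

variable {N n : ℕ} (f : Fin N → Bool × Bool) (q : Bool × Bool)

def merge (v : {i // f i = q} → Plane) (y : {i // ¬ f i = q} → Plane) : Config N :=
  fun i => if h : f i = q then v ⟨i, h⟩ else y ⟨i, h⟩

def emb (e : Fin n ≃ {i // f i = q}) (y : {i // ¬ f i = q} → Plane) (u : Config n) : Config N :=
  merge f q (fun i => aff q (u (e.symm i))) y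

def embL (e : Fin n ≃ {i // f i = q}) : Config n →L[ℝ] Config N :=
  ContinuousLinearMap.pi fun i => if h : f i = q then
    (1 / 2 : ℝ) • ContinuousLinearMap.proj (R := ℝ) (φ := fun _ : Fin n => Plane) (e.symm ⟨i, h⟩)
    else 0

lemma emb_pos (e : Fin n ≃ {i // f i = q}) (y : {i // ¬ f i = q} → Plane) (u : Config n)
    (j : Fin n) : emb f q e y u (e j) = aff q (u j) := by
  have := (e j).2
  simp [emb, merge, this]

lemma emb_neg (e : Fin n ≃ {i // f i = q}) (y : {i // ¬ f i = q} → Plane) (u : Config n)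
    (k : {i // ¬ f i = q}) : emb f q e y u k = y k := by
  simp [emb, merge, k.2]

lemma emb_hasFDerivAt (e : Fin n ≃ {i // f i = q}) (y : {i // ¬ f i = q} → Plane) (u : Config n) :
    HasFDerivAt (emb f q e y) (embL f q e) u := by
  rw [hasFDerivAt_pi']
  intro i
  by_cases h : f i = q
  · have h1 : HasFDerivAt (fun u : Config n => aff q (u (e.symm ⟨i, h⟩)))
        ((1 / 2 : ℝ) • ContinuousLinearMap.proj (R := ℝ) (φ := fun _ : Fin n => Plane)
          (e.symm ⟨i, h⟩)) u := by
      unfold aff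
      exact ((hasFDerivAt_apply (e.symm ⟨i, h⟩) u).const_smul (1 / 2 : ℝ)).const_add _
    refine (h1.congr_fderiv ?_).congr_of_eventuallyEq (Filter.Eventually.of_forall ?_)
    · ext v <;> simp [embL, h]
    · intro u; simp [emb, merge, h]
  · have h1 : HasFDerivAt (fun _ : Config n => y ⟨i, h⟩) (0 : Config n →L[ℝ] Plane) u :=
      hasFDerivAt_const _ _
    refine (h1.congr_fderiv ?_).congr_of_eventuallyEq (Filter.Eventually.of_forall ?_)
    · ext v <;> simp [embL, h]
    · intro u; simp [emb, merge, h]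

lemma embL_single (e : Fin n ≃ {i // f i = q}) (j : Fin n) (v : Plane) :
    embL f q e (Pi.single j v) = (1 / 2 : ℝ) • Pi.single (M := fun _ => Plane) (e j : Fin N) v := by
  funext i
  by_cases h : f i = q
  · by_cases hi : i = e j
    · subst hi
      simp [embL, h]
    · have : e.symm ⟨i, h⟩ ≠ j := by
        intro h'
        apply hi
        rw [← h']; simp
      simp [embL, h, hi, this]
  · have hi : i ≠ e j := by
      rintro rfl; exact h (e j).2
    simp [embL, h, hi]

lemma emb_contDiff (e : Fin n ≃ {i // f i = q}) (y : {i // ¬ f i = q} → Plane) :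
    ContDiff ℝ (⊤ : ℕ∞) (emb f q e y) := by
  rw [contDiff_pi]
  intro i
  by_cases h : f i = q
  · simp only [emb, merge, h, dite_true, aff]
    fun_prop
  · simp only [emb, merge, h, dite_false]
    fun_prop

lemma abPot_emb (e : Fin n ≃ {i // f i = q}) (y : {i // ¬ f i = q} → Plane) (u : Config n)
    (j : Fin n) : abPot N (e j) (emb f q e y u) =
      (2 : ℝ) • abPot n j u + ∑ k : {i // ¬ f i = q}, perpInv (aff q (u j) - y k) := by
  rw [abPot_eq, abPot_eq, ← Fintype.sum_subtype_add_sum_subtype (fun i => f i = q),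
    ← Equiv.sum_comp e, Finset.smul_sum]
  congr 1
  · refine Finset.sum_congr rfl fun k _ => ?_
    rw [emb_pos, emb_pos, ← perpInv_half]
    congr 1
    simp [aff, smul_sub]
  · refine Finset.sum_congr rfl fun k _ => ?_
    rw [emb_pos, emb_neg]

lemma gauge_lemma (α : ℝ) (Ψ : Config N → ℂ) (hΨ : Admissible N Ψ)
    (e : Fin n ≃ {i // f i = q}) (y : {i // ¬ f i = q} → Plane) (hy : ∀ k : {i // ¬ f i = q}, y k ∈ cell (f k)) :
    ∃ φ : Config n → ℂ, Admissible n φ ∧ (∀ u, ‖φ u‖ = ‖Ψ (emb f q e y u)‖) ∧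
      ∀ u ∈ cube n Q0, ∀ j, DSq n α j φ u = 1 / 4 * DSq N α (e j) Ψ (emb f q e y u) := by
  have hθ : ∀ k : {i // ¬ f i = q}, ∃ θ : Plane → ℝ, ContDiff ℝ (⊤ : ℕ∞) θ ∧ ∀ x ∈ cell q,
      HasFDerivAt θ (dotL (perpInv (x - y k))) x := fun k =>
    theta_cell q (f k) (fun h => k.2 h.symm) (y k) (hy k)
  choose θ hθ1 hθ2 using hθ
  set Θ : Config n → ℝ := fun u => ∑ j, ∑ k, θ k (aff q (u j)) with hΘ
  have haff : ContDiff ℝ (⊤ : ℕ∞) (aff q) := by unfold aff; fun_prop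
  have hΘs : ContDiff ℝ (⊤ : ℕ∞) Θ := by
    refine ContDiff.sum fun j _ => ContDiff.sum fun k _ => ?_
    exact (hθ1 k).comp (haff.comp (by fun_prop))
  have hnorm : ∀ r : ℝ, ‖Complex.exp (Complex.I * (r : ℂ))‖ = 1 := by
    intro r; rw [mul_comm]; exact Complex.norm_exp_ofReal_mul_I r
  refine ⟨fun u => Complex.exp (Complex.I * ((α * Θ u : ℝ) : ℂ)) * Ψ (emb f q e y u), ?_, ?_, ?_⟩
  · refine ⟨?_, ?_, ?_⟩
    · refine ContDiff.mul ?_ (hΨ.smooth.comp (emb_contDiff f q e y))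
      refine Complex.contDiff_exp.comp (contDiff_const.mul ?_)
      exact Complex.ofRealCLM.contDiff.comp (contDiff_const.mul hΘs)
    · intro σ u
      have h1 : Θ (u ∘ σ) = Θ u := by
        simp only [hΘ]
        exact Equiv.sum_comp σ (fun j => ∑ k, θ k (aff q (u j)))
      have h2 : Ψ (emb f q e y (u ∘ σ)) = Ψ (emb f q e y u) := by
        rw [← hΨ.symm (Equiv.Perm.subtypeCongr (p := fun i => f i = q) (e.symm.trans (σ.trans e))
          (Equiv.refl _)) (emb f q e y u)]
        congr 1
        funext i
        by_cases h : f i = q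
        · have := emb_pos f q e y u (σ (e.symm ⟨i, h⟩))
          simp only [Function.comp]
          rw [Equiv.Perm.subtypeCongr.left_apply (p := fun i => f i = q) _ _ h]
          simp only [Equiv.trans_apply]
          rw [this]
          simp [emb, merge, h]
        · simp only [Function.comp]
          rw [Equiv.Perm.subtypeCongr.right_apply (p := fun i => f i = q) _ _ h]
          simp [emb, merge, h]
      simp only [h1, h2]
    · obtain ⟨U, hU, hd, hz⟩ := hΨ.vanishes
      refine ⟨emb f q e y ⁻¹' U, hU.preimage (emb_contDiff f q e y).continuous, ?_, ?_⟩
      · rintro u ⟨j, k, hjk, hu⟩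
        apply hd
        refine ⟨e j, e k, ?_, ?_⟩
        · intro h; exact hjk (e.injective (Subtype.ext h))
        · rw [emb_pos, emb_pos, hu]
      · intro u hu
        rw [hz _ hu, mul_zero]
  · intro u
    rw [norm_mul, hnorm, one_mul]
  · intro u hu j
    have hcell : ∀ j, aff q (u j) ∈ cell q := fun j =>
      (aff_mem_cell q (u j)).2 (hu j (Set.mem_univ j))
    have dΘ : HasFDerivAt Θ (∑ j, ∑ k, (dotL (perpInv (aff q (u j) - y k))).comp
        ((1 / 2 : ℝ) • ContinuousLinearMap.proj (R := ℝ) (φ := fun _ : Fin n => Plane) j)) u := by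
      refine HasFDerivAt.fun_sum fun j _ => HasFDerivAt.fun_sum fun k _ => ?_
      have h1 : HasFDerivAt (fun u : Config n => aff q (u j))
          ((1 / 2 : ℝ) • ContinuousLinearMap.proj (R := ℝ) (φ := fun _ : Fin n => Plane) j) u := by
        unfold aff
        exact ((hasFDerivAt_apply j u).const_smul (1 / 2 : ℝ)).const_add _
      exact HasFDerivAt.comp (f := fun u : Config n => aff q (u j)) u (hθ2 k _ (hcell j)) h1
    have dΨ : HasFDerivAt (fun u => Ψ (emb f q e y u))
        ((fderiv ℝ Ψ (emb f q e y u)).comp (embL f q e)) u :=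
      HasFDerivAt.comp u ((hΨ.smooth.differentiable (by simp)) _).hasFDerivAt
        (emb_hasFDerivAt f q e y u)
    have dE := ((Complex.ofRealCLM.hasFDerivAt.comp u (dΘ.const_mul α)).const_mul Complex.I).cexp
    have dφ := dE.mul dΨ
    set φ : Config n → ℂ :=
      fun u => Complex.exp (Complex.I * ((α * Θ u : ℝ) : ℂ)) * Ψ (emb f q e y u) with hφ
    set W : Plane := ∑ k : {i // ¬ f i = q}, perpInv (aff q (u j) - y k) with hW
    have hp : ∀ v : Plane, pder n j v φ u = Complex.exp (Complex.I * ((α * Θ u : ℝ) : ℂ)) *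
        (1 / 2 * pder N (e j) v Ψ (emb f q e y u) +
          Complex.I * ((α * (1 / 2 * (W.1 * v.1 + W.2 * v.2)) : ℝ) : ℂ) *
            Ψ (emb f q e y u)) := by
      intro v
      have hsum : (∑ j', ∑ k, (dotL (perpInv (aff q (u j') - y k))).comp
          ((1 / 2 : ℝ) • ContinuousLinearMap.proj (R := ℝ) (φ := fun _ : Fin n => Plane) j'))
            (Pi.single j v) = 1 / 2 * (W.1 * v.1 + W.2 * v.2) := by
        rw [_root_.sum_apply, Finset.sum_eq_single j]
        · simp only [_root_.sum_apply, ContinuousLinearMap.comp_apply, dotL_apply, hW,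
            Prod.fst_sum, Prod.snd_sum, Finset.sum_mul, ← Finset.sum_add_distrib, Finset.mul_sum]
          refine Finset.sum_congr rfl fun k _ => ?_
          simp
          ring
        · intro j' _ hj'
          simp [hj']
        · simp
      unfold pder
      have hf : fderiv ℝ φ u = _ := dφ.fderiv
      rw [hf]
      simp only [_root_.add_apply, _root_.smul_apply,
        ContinuousLinearMap.comp_apply, hsum, embL_single, map_smul, Complex.ofRealCLM_apply,
        smul_eq_mul, Function.comp, Complex.real_smul]
      push_cast
      ring
    have hab := abPot_emb f q e y u j
    rw [← hW] at hab
    have ha1 : (abPot N (e j) (emb f q e y u)).1 = 2 * (abPot n j u).1 + W.1 := by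
      rw [hab]; simp
    have ha2 : (abPot N (e j) (emb f q e y u)).2 = 2 * (abPot n j u).2 + W.2 := by
      rw [hab]; simp
    have hD1 : (DOp n α j φ u).1 = Complex.exp (Complex.I * ((α * Θ u : ℝ) : ℂ)) *
        ((1 / 2 : ℝ) * (DOp N α (e j) Ψ (emb f q e y u)).1) := by
      simp only [DOp, hp, ha1]
      simp only [hφ]
      push_cast
      linear_combination (-(α : ℂ) * (1 / 2) * W.1 * Ψ (emb f q e y u) *
        Complex.exp (Complex.I * (α * Θ u))) * Complex.I_sq
    have hD2 : (DOp n α j φ u).2 = Complex.exp (Complex.I * ((α * Θ u : ℝ) : ℂ)) *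
        ((1 / 2 : ℝ) * (DOp N α (e j) Ψ (emb f q e y u)).2) := by
      simp only [DOp, hp, ha2]
      simp only [hφ]
      push_cast
      linear_combination (-(α : ℂ) * (1 / 2) * W.2 * Ψ (emb f q e y u) *
        Complex.exp (Complex.I * (α * Θ u))) * Complex.I_sq
    unfold DSq
    rw [hD1, hD2, norm_mul, norm_mul, norm_mul, norm_mul, hnorm, Complex.norm_real]
    norm_num
    ring

end gauge

def nu : Measure Plane := volume.restrict Q0

def mu (c : Bool × Bool) : Measure Plane := Measure.map (aff c) nu

lemma measurableSet_Q0 : MeasurableSet Q0 := measurableSet_Ioo.prod measurableSet_Ioo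

lemma measurableSet_cell (c : Bool × Bool) : MeasurableSet (cell c) :=
  measurableSet_Ioo.prod measurableSet_Ioo

lemma measurable_aff (c : Bool × Bool) : Measurable (aff c) := by
  unfold aff; fun_prop

instance : IsFiniteMeasure nu := by
  unfold nu
  refine isFiniteMeasure_restrict.2 ?_
  have : Q0 ⊆ Set.Icc (0 : ℝ) 1 ×ˢ Set.Icc (0 : ℝ) 1 :=
    Set.prod_mono Ioo_subset_Icc_self Ioo_subset_Icc_self
  exact ((isCompact_Icc.prod isCompact_Icc).measure_lt_top.trans_le' (measure_mono this)).ne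

instance (c : Bool × Bool) : IsFiniteMeasure (mu c) := by
  unfold mu; infer_instance

lemma map_aff_volume (c : Bool × Bool) :
    Measure.map (aff c) volume = (4 : ENNReal) • (volume : Measure Plane) := by
  have h1 : aff c = (fun x => pt c + x) ∘ (fun x : Plane => (1 / 2 : ℝ) • x) := rfl
  rw [h1, ← Measure.map_map (by fun_prop) (by fun_prop),
    Measure.map_addHaar_smul volume (by norm_num : (1 / 2 : ℝ) ≠ 0), Measure.map_smul,
    map_add_left_eq_self]
  congr 1
  simp
  norm_num

lemma mu_eq (c : Bool × Bool) : mu c = (4 : ENNReal) • (volume.restrict (cell c)) := by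
  have h := Measure.restrict_map (μ := volume) (measurable_aff c) (measurableSet_cell c)
  have hp : aff c ⁻¹' cell c = Q0 := by
    ext x; exact aff_mem_cell c x
  rw [hp, map_aff_volume, Measure.restrict_smul] at h
  exact h.symm

def reg {N : ℕ} (f : Fin N → Bool × Bool) : Set (Config N) := Set.univ.pi fun i => cell (f i)

lemma pi_mu {N : ℕ} (f : Fin N → Bool × Bool) :
    Measure.pi (fun i => mu (f i)) = ((4 : ENNReal) ^ N) • volume.restrict (reg f) := by
  refine Measure.pi_eq fun s hs => ?_
  rw [Measure.smul_apply, reg, volume_pi, Measure.restrict_pi_pi, Measure.pi_pi]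
  simp [mu_eq, Finset.prod_mul_distrib]

lemma cube_integrable {N : ℕ} (F : Config N → ℝ) (hF : Continuous F) :
    IntegrableOn F (cube N Q0) := by
  have hc : IsCompact (Set.univ.pi fun _ : Fin N => Set.Icc (0 : ℝ) 1 ×ˢ Set.Icc (0 : ℝ) 1) :=
    isCompact_univ_pi fun _ => isCompact_Icc.prod isCompact_Icc
  refine (hF.continuousOn.integrableOn_compact hc).mono_set ?_
  exact Set.pi_mono fun i _ => Set.prod_mono Ioo_subset_Icc_self Ioo_subset_Icc_self

lemma reg_subset {N : ℕ} (f : Fin N → Bool × Bool) : reg f ⊆ cube N Q0 :=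
  Set.pi_mono fun i _ => cell_subset (f i)

lemma mu_ae (c : Bool × Bool) : ∀ᵐ x ∂(mu c), x ∈ cell c := by
  rw [mu_eq]
  exact (Measure.ae_smul_measure_le _) (ae_restrict_mem (measurableSet_cell c))

lemma emb_mp {N n : ℕ} (f : Fin N → Bool × Bool) (q : Bool × Bool) (e : Fin n ≃ {i // f i = q}) :
    MeasurePreserving (fun (u : Config n) (i : {i // f i = q}) => aff q (u (e.symm i)))
      (volume.restrict (cube n Q0)) (Measure.pi fun i : {i // f i = q} => mu (f i)) := by
  have h0 : volume.restrict (cube n Q0) = Measure.pi (fun _ : Fin n => nu) := by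
    rw [cube, volume_pi, Measure.restrict_pi_pi]; rfl
  have hm : ∀ i : {i // f i = q}, MeasurePreserving (aff q) nu (mu (f i)) := by
    intro i
    rw [i.2]
    exact ⟨measurable_aff q, rfl⟩
  have h1 := measurePreserving_piCongrLeft (α := fun _ : {i // f i = q} => Plane)
    (fun _ : {i // f i = q} => nu) e
  have h2 := measurePreserving_pi (fun _ : {i // f i = q} => nu) (fun i => mu (f i)) hm
  rw [h0]
  have h3 := h2.comp h1
  have h4 : (fun (u : Config n) (i : {i // f i = q}) => aff q (u (e.symm i))) =
      (fun (a : {i // f i = q} → Plane) i => aff q (a i)) ∘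
        (MeasurableEquiv.piCongrLeft (fun _ : {i // f i = q} => Plane) e) := by
    funext u i
    obtain ⟨j, rfl⟩ := e.surjective i
    simp only [Function.comp, Equiv.symm_apply_apply]
    rw [MeasurableEquiv.coe_piCongrLeft, Equiv.piCongrLeft_apply_apply]
  rw [h4]
  exact h3

lemma reg_nonneg {N n : ℕ} (f : Fin N → Bool × Bool) (q : Bool × Bool)
    (e : Fin n ≃ {i // f i = q}) (F : Config N → ℝ) (hF : Continuous F)
    (h : ∀ y : {i // ¬ f i = q} → Plane, (∀ k : {i // ¬ f i = q}, y k ∈ cell (f k)) →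
      0 ≤ ∫ u in cube n Q0, F (emb f q e y u)) : 0 ≤ ∫ x in reg f, F x := by
  have hi : Integrable F (Measure.pi (fun i => mu (f i))) := by
    rw [pi_mu]
    exact ((cube_integrable F hF).mono_set (reg_subset f)).smul_measure (by simp)
  have hpos : 0 ≤ ∫ x, F x ∂(Measure.pi (fun i => mu (f i))) := by
    have mp := (measurePreserving_piEquivPiSubtypeProd (fun i => mu (f i)) (fun i => f i = q)).symm
    rw [← mp.integral_comp' F]
    have hi2 := (mp.integrable_comp_emb (MeasurableEquiv.measurableEmbedding _)).2 hi
    refine le_of_le_of_eq ?_ (integral_prod_symm _ hi2).symm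
    refine integral_nonneg_of_ae ?_
    have hy : ∀ᵐ y ∂(Measure.pi fun i : {i // ¬ f i = q} => mu (f i)),
        ∀ k : {i // ¬ f i = q}, y k ∈ cell (f k) := by
      rw [ae_all_iff]
      intro k
      exact Measure.tendsto_eval_ae_ae.eventually (mu_ae (f k))
    filter_upwards [hy] with y hy
    have := h y hy
    have m2 := emb_mp f q e
    rw [← m2.map_eq, integral_map m2.measurable.aemeasurable]
    · exact this
    · refine Continuous.aestronglyMeasurable ?_
      refine hF.comp ?_
      refine continuous_pi fun i => ?_
      change Continuous fun x => merge f q x y i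
      by_cases hh : f i = q
      · simp only [merge, hh, dite_true]; fun_prop
      · simp only [merge, hh, dite_false]; fun_prop
  rw [pi_mu, integral_smul_measure] at hpos
  have h4 : 0 < ((4 : ENNReal) ^ N).toReal := by simp
  rw [smul_eq_mul] at hpos
  exact nonneg_of_mul_nonneg_right hpos h4 

lemma DSq_nonneg (N : ℕ) (α : ℝ) (j : Fin N) (Ψ : Config N → ℂ) (x : Config N) :
    0 ≤ DSq N α j Ψ x := by unfold DSq; positivity

lemma continuous_normSq {N : ℕ} {Ψ : Config N → ℂ} (h : Admissible N Ψ) :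
    Continuous fun x => ‖Ψ x‖ ^ 2 := by
  have := h.smooth.continuous
  fun_prop

lemma group_bound {N n : ℕ} (α : ℝ) (f : Fin N → Bool × Bool) (q : Bool × Bool)
    (e : Fin n ≃ {i // f i = q}) (Ψ : Config N → ℂ) (hΨ : Admissible N Ψ) (κ : ℝ)
    (hκ : ∀ φ : Config n → ℂ, Admissible n φ → (∃ y, ∀ u, ‖φ u‖ = ‖Ψ (emb f q e y u)‖) →
      κ * normSq n Q0 φ ≤ kinE n α Q0 φ) :
    4 * κ * ∫ x in reg f, ‖Ψ x‖ ^ 2 ≤ ∑ j, ∫ x in reg f, DSq N α j Ψ x := by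
  have hDc := fun j => continuous_DSq N α j Ψ hΨ
  have hNc := continuous_normSq hΨ
  have h0 := reg_nonneg f q e (fun x => (∑ j : Fin n, DSq N α (e j) Ψ x) - 4 * κ * ‖Ψ x‖ ^ 2)
    (by fun_prop) (by
      intro y hy
      obtain ⟨φ, ha, hn, hd⟩ := gauge_lemma f q α Ψ hΨ e y hy
      have hk := hκ φ ha ⟨y, hn⟩
      have hm : MeasurableSet (cube n Q0) := MeasurableSet.univ_pi fun _ => measurableSet_Q0
      have : ∫ u in cube n Q0, ((∑ j : Fin n, DSq N α (e j) Ψ (emb f q e y u)) -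
          4 * κ * ‖Ψ (emb f q e y u)‖ ^ 2) =
          ∫ u in cube n Q0, (4 * (∑ j : Fin n, DSq n α j φ u) - 4 * κ * ‖φ u‖ ^ 2) := by
        refine setIntegral_congr_fun hm ?_
        intro u hu
        simp only [hn u]
        rw [Finset.mul_sum]
        congr 1
        refine Finset.sum_congr rfl fun j _ => ?_
        rw [hd u hu j]; ring
      rw [this, integral_sub, integral_const_mul, integral_const_mul, integral_finsetSum]
      · unfold kinE normSq at hk
        linarith
      · intro j _
        exact cube_integrable _ (continuous_DSq n α j φ ha)
      · have := fun j => continuous_DSq n α j φ ha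
        exact cube_integrable _ (by fun_prop)
      · have := continuous_normSq ha
        exact cube_integrable _ (by fun_prop))
  have hI : ∀ F : Config N → ℝ, Continuous F → IntegrableOn F (reg f) := fun F hF =>
    (cube_integrable F hF).mono_set (reg_subset f)
  rw [integral_sub (hI _ (by fun_prop)) (hI _ (by fun_prop)), integral_const_mul,
    integral_finsetSum _ (fun j _ => hI _ (hDc _)),
    Equiv.sum_comp e (fun i => ∫ x in reg f, DSq N α i Ψ x)] at h0
  rw [← Fintype.sum_subtype_add_sum_subtype (fun i => f i = q)]
  have h2 : 0 ≤ ∑ i : {i // ¬ f i = q}, ∫ x in reg f, DSq N α i Ψ x :=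
    Finset.sum_nonneg fun i _ => integral_nonneg fun x => DSq_nonneg _ _ _ _ _
  linarith
  
lemma Q0_ae : Q0 =ᵐ[volume] ⋃ c, cell c := by
  have h1 : (Set.Ioo (0 : ℝ) 1) =ᵐ[volume] ⋃ b : Bool, Set.Ioo (off b) (off b + 1 / 2) := by
    have hs : (⋃ b : Bool, Set.Ioo (off b) (off b + 1 / 2)) = Set.Ioo (0 : ℝ) 1 \ {1 / 2} := by
      ext t
      simp only [Set.mem_iUnion, Bool.exists_bool, off, Set.mem_Ioo, Set.mem_sdiff,
        Set.mem_singleton_iff]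
      constructor
      · rintro (⟨a, b⟩ | ⟨a, b⟩) <;> norm_num at a b <;> refine ⟨⟨?_, ?_⟩, ?_⟩ <;>
          linarith
      · rintro ⟨⟨a, b⟩, c⟩
        rcases lt_or_gt_of_ne c with h | h
        · left; norm_num; constructor <;> linarith
        · right; norm_num; constructor <;> linarith
    rw [hs]
    exact (sdiff_null_ae_eq_self (by simp)).symm
  have h2 := Measure.set_prod_ae_eq h1 h1
  have h3 : (⋃ c, cell c) = (⋃ b : Bool, Set.Ioo (off b) (off b + 1 / 2)) ×ˢ
      (⋃ b : Bool, Set.Ioo (off b) (off b + 1 / 2)) := by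
    ext x
    simp [cell, Set.mem_iUnion]
  rw [h3]
  exact h2

lemma cube_split {N : ℕ} (F : Config N → ℝ) (hF : Continuous F) :
    ∫ x in cube N Q0, F x = ∑ f : Fin N → Bool × Bool, ∫ x in reg f, F x := by
  have h1 : cube N Q0 =ᵐ[volume] ⋃ f : Fin N → Bool × Bool, reg f := by
    have : (⋃ f : Fin N → Bool × Bool, reg f) = Set.univ.pi fun _ : Fin N => ⋃ c, cell c := by
      unfold reg
      exact Set.iUnion_univ_pi (fun (_ : Fin N) c => cell c)
    rw [this]
    exact Measure.ae_eq_set_pi fun i _ => Q0_ae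
  rw [setIntegral_congr_set h1]
  refine integral_iUnion_fintype ?_ ?_ ?_
  · intro f
    exact MeasurableSet.univ_pi fun i => measurableSet_cell _
  · intro f g hfg
    obtain ⟨i, hi⟩ := Function.ne_iff.1 hfg
    refine Set.disjoint_left.2 fun x hx hy => hi ?_
    have a := hx i (Set.mem_univ i)
    have b := hy i (Set.mem_univ i)
    have key : ∀ (b b' : Bool) (t : ℝ), t ∈ Set.Ioo (off b) (off b + 1 / 2) →
        t ∈ Set.Ioo (off b') (off b' + 1 / 2) → b = b' := by
      intro b b' t h h'
      cases b <;> cases b' <;> simp [off] at * <;> linarith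
    exact Prod.ext (key _ _ _ a.1 b.1) (key _ _ _ a.2 b.2)
  · intro f
    exact (cube_integrable F hF).mono_set (reg_subset f)

lemma kinE_nonneg (N : ℕ) (α : ℝ) (Ω : Set Plane) (Ψ : Config N → ℂ) : 0 ≤ kinE N α Ω Ψ :=
  Finset.sum_nonneg fun _ _ => integral_nonneg fun _ => DSq_nonneg _ _ _ _ _

lemma normSq_nonneg (N : ℕ) (Ω : Set Plane) (Ψ : Config N → ℂ) : 0 ≤ normSq N Ω Ψ :=
  integral_nonneg fun _ => by positivity

lemma EN_nonneg (N : ℕ) (α : ℝ) : 0 ≤ EN N α := by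
  unfold EN neumannE
  split_ifs
  · exact le_rfl
  · refine Real.sInf_nonneg ?_
    rintro E ⟨Ψ, _, _, rfl⟩
    exact kinE_nonneg _ _ _ _

lemma scale_adm {N : ℕ} {Ψ : Config N → ℂ} (h : Admissible N Ψ) (r : ℝ) :
    Admissible N (fun x => (r : ℂ) * Ψ x) := by
  refine ⟨contDiff_const.mul h.smooth, ?_, ?_⟩
  · intro σ x
    simp only [h.symm σ x]
  · obtain ⟨U, hU, hd, hz⟩ := h.vanishes
    exact ⟨U, hU, hd, fun x hx => by rw [hz x hx, mul_zero]⟩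

lemma scale_DSq {N : ℕ} {Ψ : Config N → ℂ} (h : Admissible N Ψ) (r α : ℝ) (j : Fin N)
    (x : Config N) : DSq N α j (fun x => (r : ℂ) * Ψ x) x = r ^ 2 * DSq N α j Ψ x := by
  have hp : ∀ v, pder N j v (fun x => (r : ℂ) * Ψ x) x = r * pder N j v Ψ x := by
    intro v
    unfold pder
    rw [fderiv_const_mul ((h.smooth.differentiable (by simp)) x)]
    simp
  have h1 : (DOp N α j (fun x => (r : ℂ) * Ψ x) x).1 = r * (DOp N α j Ψ x).1 := by
    simp only [DOp, hp]; ring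
  have h2 : (DOp N α j (fun x => (r : ℂ) * Ψ x) x).2 = r * (DOp N α j Ψ x).2 := by
    simp only [DOp, hp]; ring
  unfold DSq
  rw [h1, h2, norm_mul, norm_mul, Complex.norm_real, mul_pow, mul_pow, Real.norm_eq_abs, sq_abs]
  ring

lemma scale_kinE {N : ℕ} {Ψ : Config N → ℂ} (h : Admissible N Ψ) (r α : ℝ) (Ω : Set Plane) :
    kinE N α Ω (fun x => (r : ℂ) * Ψ x) = r ^ 2 * kinE N α Ω Ψ := by
  unfold kinE
  simp only [scale_DSq h, integral_const_mul, Finset.mul_sum]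

lemma scale_normSq {N : ℕ} (Ψ : Config N → ℂ) (r : ℝ) (Ω : Set Plane) :
    normSq N Ω (fun x => (r : ℂ) * Ψ x) = r ^ 2 * normSq N Ω Ψ := by
  unfold normSq
  rw [← integral_const_mul]
  congr 1
  funext x
  rw [norm_mul, mul_pow, Complex.norm_real, Real.norm_eq_abs, sq_abs]

lemma scale_exists {N : ℕ} {Ψ : Config N → ℂ} (_h : Admissible N Ψ) (hp : 0 < normSq N Q0 Ψ) :
    ∃ r : ℝ, r ^ 2 * normSq N Q0 Ψ = 1 := by
  refine ⟨(Real.sqrt (normSq N Q0 Ψ))⁻¹, ?_⟩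
  rw [inv_pow, Real.sq_sqrt hp.le, inv_mul_cancel₀ hp.ne']

lemma EN_bound {n : ℕ} (hn : n ≠ 0) (α : ℝ) (φ : Config n → ℂ) (h : Admissible n φ) :
    EN n α * normSq n Q0 φ ≤ kinE n α Q0 φ := by
  rcases (normSq_nonneg n Q0 φ).eq_or_lt with h0 | h0
  · rw [← h0, mul_zero]; exact kinE_nonneg _ _ _ _
  · obtain ⟨r, hr⟩ := scale_exists h h0
    have h1 : EN n α ≤ r ^ 2 * kinE n α Q0 φ := by
      unfold EN neumannE
      rw [if_neg hn]
      refine csInf_le ⟨0, ?_⟩ ⟨fun x => (r : ℂ) * φ x, scale_adm h r, ?_, ?_⟩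
      · rintro E ⟨Ψ, _, _, rfl⟩
        exact kinE_nonneg _ _ _ _
      · rw [scale_normSq, hr]
      · rw [scale_kinE h]
    calc EN n α * normSq n Q0 φ ≤ (r ^ 2 * kinE n α Q0 φ) * normSq n Q0 φ := by gcongr
      _ = (r ^ 2 * normSq n Q0 φ) * kinE n α Q0 φ := by ring
      _ = kinE n α Q0 φ := by rw [hr, one_mul]

/-- Existence of a normalised admissible function. -/
lemma exists_adm (N : ℕ) : ∃ Ψ : Config N → ℂ, Admissible N Ψ ∧ normSq N Q0 Ψ = 1 := by
  set T : Config N → ℝ := fun x => ∏ j, ∏ k, if j = k then (1 : ℝ) else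
    ((x j).1 - (x k).1) ^ 2 + ((x j).2 - (x k).2) ^ 2 with hT
  have hTs : ContDiff ℝ (⊤ : ℕ∞) T := by
    refine contDiff_prod fun j _ => contDiff_prod fun k _ => ?_
    split_ifs
    · exact contDiff_const
    · fun_prop
  set x0 : Config N := fun i => (((i : ℕ) + 1 : ℝ) / (N + 1), 1 / 2) with hx0
  have hx0c : x0 ∈ cube N Q0 := by
    intro i _
    have hi : ((i : ℕ) : ℝ) < N := by exact_mod_cast i.2
    refine ⟨⟨?_, ?_⟩, ?_, ?_⟩
    · simp only [hx0]; positivity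
    · simp only [hx0]; rw [div_lt_one (by positivity)]; linarith
    · simp only [hx0]; norm_num
    · simp only [hx0]; norm_num
  have hT0 : 0 < T x0 := by
    refine Finset.prod_pos fun j _ => Finset.prod_pos fun k _ => ?_
    split_ifs with h
    · exact one_pos
    · have : (x0 j).1 - (x0 k).1 ≠ 0 := by
        intro h0
        apply h
        simp only [hx0] at h0
        have hN : (N + 1 : ℝ) ≠ 0 := by positivity
        field_simp at h0
        have : ((j : ℕ) : ℝ) = (k : ℕ) := by linarith
        exact Fin.ext (by exact_mod_cast this)
      positivity
  have hdiag : ∀ x ∈ diagSet N, T x = 0 := by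
    rintro x ⟨j, k, hjk, hx⟩
    refine Finset.prod_eq_zero (Finset.mem_univ j) (Finset.prod_eq_zero (Finset.mem_univ k) ?_)
    rw [if_neg hjk, hx]; simp
  set Φ : Config N → ℂ := fun x => ((expNegInvGlue (T x - T x0 / 2) : ℝ) : ℂ) with hΦ
  have hadm : Admissible N Φ := by
    refine ⟨?_, ?_, ?_⟩
    · exact Complex.ofRealCLM.contDiff.comp
        (expNegInvGlue.contDiff.comp (hTs.sub contDiff_const))
    · intro σ x
      have : T (x ∘ σ) = T x := by
        simp only [hT, Function.comp]
        rw [← Equiv.prod_comp σ (fun j => ∏ k, if j = k then (1 : ℝ) else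
          ((x j).1 - (x k).1) ^ 2 + ((x j).2 - (x k).2) ^ 2)]
        refine Finset.prod_congr rfl fun j _ => ?_
        rw [← Equiv.prod_comp σ (fun k => if σ j = k then (1 : ℝ) else
          ((x (σ j)).1 - (x k).1) ^ 2 + ((x (σ j)).2 - (x k).2) ^ 2)]
        refine Finset.prod_congr rfl fun k _ => ?_
        simp
      simp only [hΦ, this]
    · refine ⟨{x | T x < T x0 / 2}, isOpen_lt hTs.continuous continuous_const, ?_, ?_⟩
      · intro x hx
        simp only [Set.mem_ofPred_eq, hdiag x hx]; linarith
      · intro x hx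
        simp only [Set.mem_ofPred_eq] at hx
        simp only [hΦ]
        rw [expNegInvGlue.zero_of_nonpos (by linarith)]; simp
  have hpos : 0 < normSq N Q0 Φ := by
    unfold normSq
    have ho : IsOpen (cube N Q0) :=
      isOpen_set_pi Set.finite_univ fun _ _ => isOpen_Ioo.prod isOpen_Ioo
    have hc := continuous_normSq hadm
    rw [setIntegral_pos_iff_support_of_nonneg_ae
      (Filter.Eventually.of_forall fun x => by positivity) (cube_integrable _ hc)]
    refine IsOpen.measure_pos _ (hc.isOpen_support.inter ho) ⟨x0, ?_, hx0c⟩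
    simp only [Function.mem_support, hΦ]
    have := expNegInvGlue.pos_of_pos (x := T x0 - T x0 / 2) (by linarith)
    rw [Complex.norm_real]
    have := norm_pos_iff.2 this.ne'
    positivity
  obtain ⟨r, hr⟩ := scale_exists hadm hpos
  exact ⟨_, scale_adm hadm r, by rw [scale_normSq, hr]⟩

/-- `Ψ` vanishes when all the particles are within distance `2^{-K}`. -/
def Van (N K : ℕ) (Ψ : Config N → ℂ) : Prop :=
  ∀ x ∈ cube N Q0, (∀ i j, dist (x i) (x j) ≤ (1 / 2 : ℝ) ^ K) → Ψ x = 0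

lemma exists_van {N : ℕ} (hN : 2 ≤ N) (Ψ : Config N → ℂ) (h : Admissible N Ψ) :
    ∃ K, Van N K Ψ := by
  obtain ⟨U, hU, hd, hz⟩ := h.vanishes
  have hc : IsCompact ((Set.univ.pi fun _ : Fin N => Set.Icc (0 : ℝ) 1 ×ˢ Set.Icc (0 : ℝ) 1) \ U) :=
    (isCompact_univ_pi fun _ => isCompact_Icc.prod isCompact_Icc).diff hU
  set a : Fin N := ⟨0, by omega⟩
  set b : Fin N := ⟨1, by omega⟩
  have hab : a ≠ b := by simp [a, b]
  have hpos : ∃ δ > 0, ∀ x ∈ ((Set.univ.pi fun _ : Fin N => Set.Icc (0 : ℝ) 1 ×ˢ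
      Set.Icc (0 : ℝ) 1) \ U), δ ≤ dist (x a) (x b) := by
    rcases Set.eq_empty_or_nonempty ((Set.univ.pi fun _ : Fin N => Set.Icc (0 : ℝ) 1 ×ˢ
      Set.Icc (0 : ℝ) 1) \ U) with he | hne
    · exact ⟨1, one_pos, by rw [he]; simp⟩
    · obtain ⟨x, hx, hm⟩ := hc.exists_isMinOn hne
        (f := fun x : Config N => dist (x a) (x b)) (by fun_prop)
      refine ⟨dist (x a) (x b), ?_, fun z hz => hm hz⟩
      refine dist_pos.2 fun h0 => hx.2 (hd ⟨a, b, hab, h0⟩)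
  obtain ⟨δ, hδ, hm⟩ := hpos
  obtain ⟨K, hK⟩ := exists_pow_lt_of_lt_one hδ (by norm_num : (1 / 2 : ℝ) < 1)
  refine ⟨K, fun x hx hx2 => ?_⟩
  by_contra hne
  have hxU : x ∉ U := fun h => hne (hz x h)
  have := hm x ⟨fun i hi => ⟨Ioo_subset_Icc_self (hx i hi).1, Ioo_subset_Icc_self (hx i hi).2⟩, hxU⟩
  linarith [hx2 a b]

lemma van_zero {N : ℕ} {Ψ : Config N → ℂ} (h : Van N 0 Ψ) : normSq N Q0 Ψ = 0 := by
  unfold normSq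
  have hm : MeasurableSet (cube N Q0) := MeasurableSet.univ_pi fun _ => measurableSet_Q0
  rw [setIntegral_congr_fun (g := fun _ => 0) hm]
  · simp
  · intro x hx
    have : Ψ x = 0 := by
      refine h x hx fun i j => ?_
      have hi := hx i (Set.mem_univ i)
      have hj := hx j (Set.mem_univ j)
      rw [pow_zero, Prod.dist_eq, max_le_iff, Real.dist_eq, Real.dist_eq, abs_le, abs_le]
      refine ⟨⟨?_, ?_⟩, ?_, ?_⟩ <;> linarith [hi.1.1, hi.1.2, hi.2.1, hi.2.2, hj.1.1, hj.1.2,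
        hj.2.1, hj.2.2]
    simp [this]

lemma step {N : ℕ} (hN : 5 ≤ N) (α c : ℝ) (hc : 0 ≤ c)
    (ih : ∀ n, 2 ≤ n → n < N → ∀ φ : Config n → ℂ, Admissible n φ →
      (n : ℝ) / 4 * c * normSq n Q0 φ ≤ kinE n α Q0 φ) (K : ℕ) :
    ∀ Ψ : Config N → ℂ, Admissible N Ψ → Van N K Ψ →
      (N : ℝ) / 4 * c * normSq N Q0 Ψ ≤ kinE N α Q0 Ψ := by
  induction K with
  | zero =>
    intro Ψ _ hV
    rw [van_zero hV, mul_zero]; exact kinE_nonneg _ _ _ _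
  | succ K ihK =>
    intro Ψ hΨ hV
    have hn : normSq N Q0 Ψ = ∑ f : Fin N → Bool × Bool, ∫ x in reg f, ‖Ψ x‖ ^ 2 :=
      cube_split _ (continuous_normSq hΨ)
    have hk : kinE N α Q0 Ψ = ∑ f : Fin N → Bool × Bool, ∑ j, ∫ x in reg f, DSq N α j Ψ x := by
      unfold kinE
      rw [Finset.sum_comm]
      exact Finset.sum_congr rfl fun j _ => cube_split _ (continuous_DSq N α j Ψ hΨ)
    rw [hn, hk, Finset.mul_sum]
    refine Finset.sum_le_sum fun f _ => ?_
    obtain ⟨q, hq⟩ : ∃ q, N ≤ 4 * Fintype.card {i // f i = q} := by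
      by_contra! hcon
      have h1 : ∑ q : Bool × Bool, Fintype.card {i // f i = q} = N := by
        rw [← Fintype.card_sigma, Fintype.card_congr (Equiv.sigmaFiberEquiv f), Fintype.card_fin]
      have h2 : ∑ q : Bool × Bool, 4 * Fintype.card {i // f i = q} < ∑ q : Bool × Bool, N :=
        Finset.sum_lt_sum_of_nonempty Finset.univ_nonempty fun q _ => hcon q
      rw [← Finset.mul_sum, h1] at h2
      simp at h2
    have hle : Fintype.card {i // f i = q} ≤ N := by
      simpa using Fintype.card_subtype_le (fun i => f i = q)
    obtain ⟨n, hn⟩ : ∃ n, n = Fintype.card {i // f i = q} := ⟨_, rfl⟩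
    have e : Fin n ≃ {i // f i = q} := (Fintype.equivFinOfCardEq hn.symm).symm
    rw [← hn] at hq hle
    have hq' : (N : ℝ) ≤ 4 * n := by exact_mod_cast hq
    have hI : 0 ≤ ∫ x in reg f, ‖Ψ x‖ ^ 2 := integral_nonneg fun x => by positivity
    have key := group_bound α f q e Ψ hΨ ((n : ℝ) / 4 * c) (by
      intro φ hφ hy
      rcases hle.lt_or_eq with hlt | heq
      · exact ih n (by omega) hlt φ hφ
      · subst heq
        refine ihK φ hφ ?_
        obtain ⟨y, hy⟩ := hy
        have hall : ∀ i, f i = q := by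
          intro i
          have hinj := Subtype.val_injective.comp e.injective
          obtain ⟨j, rfl⟩ := Finite.surjective_of_injective hinj i
          exact (e j).2
        intro x hx hxd
        have hz : Ψ (emb f q e y x) = 0 := by
          have hemb : ∀ i, emb f q e y x i = aff q (x (e.symm ⟨i, hall i⟩)) := by
            intro i
            simp [emb, merge, hall i]
          refine hV _ ?_ ?_
          · intro i _
            rw [hemb]
            exact cell_subset q ((aff_mem_cell q _).2 (hx _ (Set.mem_univ _)))
          · intro i j
            rw [hemb, hemb, aff, aff, dist_add_left, dist_smul₀, pow_succ]
            have := hxd (e.symm ⟨i, hall i⟩) (e.symm ⟨j, hall j⟩)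
            norm_num
            linarith
        have := hy x
        rw [hz, norm_zero] at this
        exact norm_eq_zero.1 this)
    refine le_trans (mul_le_mul_of_nonneg_right ?_ hI) key
    nlinarith

/-- Linear lower bound in terms of few-particle energies: for every
`α ∈ [0,1]` and every `N ≥ 2`, `E^N_N(α) ≥ (N/4) min{E^N_2(α), E^N_3(α), E^N_4(α)}`. -/
theorem linear_lower_bound (α : ℝ) (hα : α ∈ Set.Icc (0 : ℝ) 1) (N : ℕ) (hN : 2 ≤ N) :
    (N : ℝ) / 4 * min (EN 2 α) (min (EN 3 α) (EN 4 α)) ≤ EN N α := by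
  set c := min (EN 2 α) (min (EN 3 α) (EN 4 α)) with hcdef
  have hc : 0 ≤ c := le_min (EN_nonneg _ _) (le_min (EN_nonneg _ _) (EN_nonneg _ _))
  have main : ∀ n, 2 ≤ n → ∀ φ : Config n → ℂ, Admissible n φ →
      (n : ℝ) / 4 * c * normSq n Q0 φ ≤ kinE n α Q0 φ := by
    intro n
    induction n using Nat.strong_induction_on with
    | _ n ih =>
      intro h2 φ hφ
      by_cases h5 : 5 ≤ n
      · obtain ⟨K, hK⟩ := exists_van h2 φ hφ
        exact step h5 α c hc (fun m hm hmn => ih m hmn hm) K φ hφ hK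
      · refine le_trans ?_ (EN_bound (by omega) α φ hφ)
        have hcn : c ≤ EN n α := by
          have : n = 2 ∨ n = 3 ∨ n = 4 := by omega
          rcases this with rfl | rfl | rfl
          · exact min_le_left _ _
          · exact (min_le_right _ _).trans (min_le_left _ _)
          · exact (min_le_right _ _).trans (min_le_right _ _)
        have hn4 : (n : ℝ) ≤ 4 := by exact_mod_cast (by omega : n ≤ 4)
        refine mul_le_mul_of_nonneg_right ?_ (normSq_nonneg _ _ _)
        nlinarith
  unfold EN neumannE
  rw [if_neg (by omega)]
  refine le_csInf ?_ ?_
  · obtain ⟨Ψ, h1, h2⟩ := exists_adm N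
    exact ⟨_, Ψ, h1, h2, rfl⟩
  · rintro E ⟨Ψ, h1, h2, rfl⟩
    have := main N hN Ψ h1
    rwa [h2, mul_one] at this
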